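/- arXiv:1908.11201 — 2 statements merged into one kernel-verified Lean document; each statement's English description precedes it below -/
import Mathlib

section
/- Let $p_1,p_2,p_3,p_4$ be positive integers, let $b_1,\ldots,b_{p_3}$ be integers with $0 \le b_1 \le b_i$ for all $i=1,\ldots,p_3$, and let $c_2,\ldots,c_{p_2}$ be integers with $0 \le c_2 \le c_j$ for all $j=2,\ldots,p_2$ (this last condition being vacuous when $p_2=1$). Set $E_1 := -p_1 - p_4 + b_1 p_2 - 2\sum_{j=2}^{p_2} c_j + \sum_{i=1}^{p_3}(b_1 - 2b_i - 1)$ and $E_3 := c_2(p_2+1) - 2\left(\sum_{j=2}^{p_2} c_j + b_1 + 1\right)$. Then it is impossible that all three of the following hold simultaneously: (a) $E_1 \ge 0$; (b) if $p_2 \ge 2$ and $p_3 \ge 2$ then $-p_1 - p_4 \ge 0$; (c) if $p_2 \ge 2$ then $E_3 \ge 0$. -/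
/-- The arithmetic core of the proof that the second Chern character of
any projective toric manifold of Picard number three without a Fano contraction is
not nef: the system of integer inequalities obtained from nefness is inconsistent. -/
theorem stmt_0 (p₁ p₂ p₃ p₄ : ℕ) (hp₁ : 0 < p₁) (hp₂ : 0 < p₂) (hp₃ : 0 < p₃)
    (hp₄ : 0 < p₄) (b c : ℕ → ℤ)
    (hb : ∀ i ∈ Finset.Icc 1 p₃, 0 ≤ b 1 ∧ b 1 ≤ b i)
    (hc : ∀ j ∈ Finset.Icc 2 p₂, 0 ≤ c 2 ∧ c 2 ≤ c j) :
    ¬ ((-(p₁ : ℤ) - p₄ + b 1 * p₂ - 2 * ∑ j ∈ Finset.Icc 2 p₂, c j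
          + ∑ i ∈ Finset.Icc 1 p₃, (b 1 - 2 * b i - 1) ≥ 0)
      ∧ (2 ≤ p₂ → 2 ≤ p₃ → -(p₁ : ℤ) - p₄ ≥ 0)
      ∧ (2 ≤ p₂ →
          c 2 * ((p₂ : ℤ) + 1) - 2 * ((∑ j ∈ Finset.Icc 2 p₂, c j) + b 1 + 1) ≥ 0)) := by
  rintro ⟨h₁, h₂, h₃⟩
  obtain ⟨hb0, -⟩ := hb 1 (Finset.mem_Icc.mpr ⟨le_rfl, hp₃⟩)
  rcases Nat.lt_or_ge p₂ 2 with h | hp₂'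
  · obtain rfl : p₂ = 1 := by omega
    have hsum : ∑ i ∈ Finset.Icc 1 p₃, (b 1 - 2 * b i - 1) ≤ b 1 - 2 * b 1 - 1 := by
      rw [← Finset.add_sum_Ioc_eq_sum_Icc hp₃]
      have : ∑ i ∈ Finset.Ioc 1 p₃, (b 1 - 2 * b i - 1) ≤ 0 :=
        Finset.sum_nonpos fun i hi => by
          have := hb i (Finset.Ioc_subset_Icc_self hi)
          omega
      omega
    rw [Finset.Icc_eq_empty (by norm_num : ¬ 2 ≤ 1), Finset.sum_empty] at h₁
    omega
  · rcases Nat.lt_or_ge p₃ 2 with h | hp₃'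
    · obtain rfl : p₃ = 1 := by omega
      obtain ⟨hc0, -⟩ := hc 2 (Finset.mem_Icc.mpr ⟨le_rfl, hp₂'⟩)
      specialize h₃ hp₂'
      obtain ⟨n, rfl⟩ : ∃ n, p₂ = n + 1 := ⟨p₂ - 1, by omega⟩
      have hS : (n : ℤ) * c 2 ≤ ∑ j ∈ Finset.Icc 2 (n + 1), c j := by
        simpa using Finset.card_nsmul_le_sum _ c (c 2) fun j hj => (hc j hj).2
      generalize ∑ j ∈ Finset.Icc 2 (n + 1), c j = S at *
      simp only [Finset.Icc_self, Finset.sum_singleton] at h₁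
      push_cast at h₁ h₃
      have hbn : 2 * S + 3 ≤ b 1 * n := by
        linarith [show (1 : ℤ) ≤ p₁ by omega, show (1 : ℤ) ≤ p₄ by omega]
      have hn : (0 : ℤ) ≤ n := by positivity
      have hnc : 0 ≤ (n : ℤ) * c 2 := mul_nonneg hn hc0
      nlinarith [mul_nonneg hn h₃, mul_nonneg hn (sub_nonneg.mpr hS), mul_nonneg hn hnc]
    · have := h₂ hp₂' hp₃'
      omega
end

section
/- Let $p_1,p_2,p_3,p_4$ be positive integers, let $b_1,\ldots,b_{p_3}$ be integers with $0 \le b_1 \le b_i$ for all $i=1,\ldots,p_3$, and let $c_2,\ldots,c_{p_2}$ be integers with $0 \le c_2 \le c_j$ for all $j=2,\ldots,p_2$. If $-p_1 - p_4 + b_1 p_2 - 2\sum_{j=2}^{p_2} c_j + \sum_{i=1}^{p_3}(b_1 - 2b_i - 1) \ge 0$, then $b_1 \ge 1$ and $p_2 > p_3$ (in particular $p_2 \ge 2$). -/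
/-- Arithmetic content of Lemma 3.2: if the quantity
`E₁ = -p₁ - p₄ + b₁ p₂ - 2 ∑ c_j + ∑ (b₁ - 2 b_i - 1)` is nonnegative,
then `b₁ ≥ 1` and `p₂ > p₃` (in particular `p₂ ≥ 2`). -/
theorem stmt_1 (p₁ p₂ p₃ p₄ : ℕ) (hp₁ : 0 < p₁) (hp₂ : 0 < p₂) (hp₃ : 0 < p₃)
    (hp₄ : 0 < p₄) (b c : ℕ → ℤ)
    (hb : ∀ i ∈ Finset.Icc 1 p₃, 0 ≤ b 1 ∧ b 1 ≤ b i)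
    (hc : ∀ j ∈ Finset.Icc 2 p₂, 0 ≤ c 2 ∧ c 2 ≤ c j)
    (hE₁ : -(p₁ : ℤ) - p₄ + b 1 * p₂ - 2 * ∑ j ∈ Finset.Icc 2 p₂, c j
          + ∑ i ∈ Finset.Icc 1 p₃, (b 1 - 2 * b i - 1) ≥ 0) :
    1 ≤ b 1 ∧ p₃ < p₂ ∧ 2 ≤ p₂ := by
  have hb1 : 0 ≤ b 1 := (hb 1 (Finset.mem_Icc.2 ⟨le_rfl, hp₃⟩)).1
  have hcsum : 0 ≤ ∑ j ∈ Finset.Icc 2 p₂, c j :=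
    Finset.sum_nonneg fun j hj => (hc j hj).1.trans (hc j hj).2
  have hbsum : ∑ i ∈ Finset.Icc 1 p₃, (b 1 - 2 * b i - 1) ≤ p₃ * (-b 1 - 1) := by
    have h := Finset.sum_le_card_nsmul (Finset.Icc 1 p₃) (fun i => b 1 - 2 * b i - 1)
      (-b 1 - 1) fun i hi => by linarith [(hb i hi).2]
    simpa using h
  have hpos : 0 < b 1 * ((p₂ : ℤ) - p₃) := by
    have : (0 : ℤ) < p₁ := mod_cast hp₁
    have : (0 : ℤ) < p₃ := mod_cast hp₃
    have : (0 : ℤ) < p₄ := mod_cast hp₄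
    linarith
  have hdiff : 0 < (p₂ : ℤ) - p₃ := pos_of_mul_pos_right hpos hb1
  have hb1' : 0 < b 1 := pos_of_mul_pos_left hpos hdiff.le
  omega
end
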